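/- arXiv:1108.3635 — 2 statements merged into one kernel-verified Lean document; each statement's English description precedes it below -/
import Mathlib

section
/- In any infinite word that is an infinite concatenation of words from {110010, 110100}, the factor 11 has exactly one abelian return, namely the abelian class of 110010 (which is abelian equivalent to 110100). In particular, there exist aperiodic recurrent infinite words having a factor with exactly one abelian return. -/
variable {α : Type*}

/-- The factor of the infinite word `w` of length `n` starting at position `i`. -/
def factorAt (w : ℕ → α) (i n : ℕ) : List α :=
  (List.range n).map fun k => w (i + k)

/-- `u` is a factor of the infinite word `w`. -/
def IsFactor (w : ℕ → α) (u : List α) : Prop :=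
  ∃ i, factorAt w i u.length = u

/-- `w` is recurrent: each of its factors occurs infinitely many times. -/
def Recurrent (w : ℕ → α) : Prop :=
  ∀ u : List α, IsFactor w u → ∀ N : ℕ, ∃ i, N ≤ i ∧ factorAt w i u.length = u

/-- `w` is periodic: there is `T > 0` with `w (n + T) = w n` for all `n`. -/
def Periodic (w : ℕ → α) : Prop :=
  ∃ T : ℕ, 0 < T ∧ ∀ n, w (n + T) = w n

def Aperiodic (w : ℕ → α) : Prop := ¬ Periodic w

def UltimatelyPeriodic (w : ℕ → α) : Prop :=
  ∃ N T : ℕ, 0 < T ∧ ∀ n, N ≤ n → w (n + T) = w n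

/-- `w` is Sturmian: aperiodic with subword complexity `n + 1`. -/
def Sturmian (w : ℕ → α) : Prop :=
  Aperiodic w ∧ ∀ n : ℕ, {u : List α | u.length = n ∧ IsFactor w u}.ncard = n + 1

/-- Positions where `u` occurs in `w`. -/
def Occurrences (w : ℕ → α) (u : List α) : Set ℕ :=
  {i | factorAt w i u.length = u}

/-- The return words of `u` in `w`: words from one occurrence of `u` to the next. -/
def ReturnWords (w : ℕ → α) (u : List α) : Set (List α) :=
  {r | ∃ i j : ℕ, i ∈ Occurrences w u ∧ j ∈ Occurrences w u ∧ i < j ∧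
    (∀ k, i < k → k < j → k ∉ Occurrences w u) ∧ r = factorAt w i (j - i)}

/-- Positions where a word abelian-equivalent to `u` occurs in `w`. -/
def AbelianOccurrences (w : ℕ → α) (u : List α) : Set ℕ :=
  {i | List.Perm (factorAt w i u.length) u}

/-- The abelian return words of `u` in `w`. -/
def AbelianReturnWords (w : ℕ → α) (u : List α) : Set (List α) :=
  {r | ∃ i j : ℕ, i ∈ AbelianOccurrences w u ∧ j ∈ AbelianOccurrences w u ∧ i < j ∧
    (∀ k, i < k → k < j → k ∉ AbelianOccurrences w u) ∧ r = factorAt w i (j - i)}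

/-- The abelian equivalence classes (as multisets) of the abelian return words of `u` in `w`. -/
def abelianReturnClasses (w : ℕ → α) (u : List α) : Set (Multiset α) :=
  (fun r : List α => (r : Multiset α)) '' AbelianReturnWords w u

def RightSpecial (w : ℕ → α) (u : List α) : Prop :=
  ∃ a b : α, a ≠ b ∧ IsFactor w (u ++ [a]) ∧ IsFactor w (u ++ [b])

def LeftSpecial (w : ℕ → α) (u : List α) : Prop :=
  ∃ a b : α, a ≠ b ∧ IsFactor w (a :: u) ∧ IsFactor w (b :: u)

def Bispecial (w : ℕ → α) (u : List α) : Prop :=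
  RightSpecial w u ∧ LeftSpecial w u

/-- A factor is singular if it is the only factor of `w` in its abelian class. -/
def Singular (w : ℕ → α) (u : List α) : Prop :=
  ∀ v : List α, IsFactor w v → List.Perm v u → v = u

/-- `w` is an infinite concatenation of words from `S`. -/
def InfConcat (S : Set (List α)) (w : ℕ → α) : Prop :=
  ∃ f : ℕ → List α, (∀ n, f n ∈ S) ∧
    ∀ n, factorAt w (((List.range n).map fun k => (f k).length).sum) (f n).length = f n

/-- A finite binary word is balanced if any two factors of equal length have numbers
of occurrences of `true` differing by at most one. -/
def BalancedList (w : List Bool) : Prop :=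
  ∀ u v : List Bool, u <:+: w → v <:+: w → u.length = v.length →
    |(u.count true : ℤ) - (v.count true : ℤ)| ≤ 1


/-- The two words `110010` and `110100`, indexed by their fourth letter. -/
def returnBlock (b : Bool) : List Bool :=
  [true, true, false, b, !b, false]

theorem mem_blocks_iff_eq_returnBlock (u : List Bool) :
    u ∈ ({[true, true, false, false, true, false],
      [true, true, false, true, false, false]} : Set (List Bool)) ↔ ∃ b, u = returnBlock b := by
  simp [returnBlock]

theorem factorAt_six_eq_returnBlock_iff (w : ℕ → Bool) (i : ℕ) (b : Bool) :
    factorAt w i 6 = returnBlock b ↔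
      w i = true ∧ w (i + 1) = true ∧ w (i + 2) = false ∧ w (i + 3) = b ∧
        w (i + 4) = !b ∧ w (i + 5) = false := by
  simp [factorAt, returnBlock, List.range_succ]

/-- Positions divisible by six in a concatenation of the two blocks start a block. -/
theorem InfConcat.exists_factorAt_eq_returnBlock {w : ℕ → Bool}
    (h : InfConcat
      {[true, true, false, false, true, false], [true, true, false, true, false, false]} w)
    (n : ℕ) : ∃ b, factorAt w (6 * n) 6 = returnBlock b := by
  obtain ⟨f, hf, hw⟩ := h
  have hlen : ∀ k, (f k).length = 6 := by
    intro k
    obtain ⟨b, hb⟩ := (mem_blocks_iff_eq_returnBlock _).1 (hf k)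
    simp [hb, returnBlock]
  obtain ⟨b, hb⟩ := (mem_blocks_iff_eq_returnBlock _).1 (hf n)
  refine ⟨b, ?_⟩
  have := hw n
  simp only [hlen, List.map_const', List.length_range, List.sum_replicate, smul_eq_mul] at this
  rw [← hb, ← this, mul_comm]

theorem infConcat_of_forall_factorAt {w : ℕ → Bool} (b : ℕ → Bool)
    (h : ∀ n, factorAt w (6 * n) 6 = returnBlock (b n)) :
    InfConcat
      {[true, true, false, false, true, false], [true, true, false, true, false, false]} w := by
  refine ⟨fun n => returnBlock (b n), fun n => (mem_blocks_iff_eq_returnBlock _).2 ⟨b n, rfl⟩, ?_⟩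
  intro n
  simpa [returnBlock, mul_comm] using h n

theorem mem_abelianOccurrences_true_true_iff (w : ℕ → Bool) (i : ℕ) :
    i ∈ AbelianOccurrences w [true, true] ↔ w i = true ∧ w (i + 1) = true := by
  simp only [AbelianOccurrences, factorAt, Set.mem_ofPred_eq, List.length_cons, List.length_nil,
    List.range_succ, List.range_zero, List.nil_append, List.cons_append, List.map_cons,
    List.map_nil, Nat.add_zero, Nat.zero_add]
  generalize w i = x
  generalize w (i + 1) = y
  revert x y
  decide

theorem mem_abelianOccurrences_iff_six_dvd {w : ℕ → Bool}
    (h : ∀ n, ∃ b, factorAt w (6 * n) 6 = returnBlock b) (i : ℕ) :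
    i ∈ AbelianOccurrences w [true, true] ↔ 6 ∣ i := by
  rw [mem_abelianOccurrences_true_true_iff]
  obtain ⟨b, hb⟩ := h (i / 6)
  obtain ⟨c, hc⟩ := h (i / 6 + 1)
  rw [factorAt_six_eq_returnBlock_iff] at hb hc
  obtain ⟨r, hr, hi⟩ : ∃ r < 6, i = 6 * (i / 6) + r := ⟨i % 6, by omega, by omega⟩
  generalize i / 6 = q at hb hc hi
  subst hi
  rw [mul_add, mul_one] at hc
  obtain ⟨h0, h1, h2, h3, h4, h5⟩ := hb
  have hdvd : 6 ∣ 6 * q + r ↔ r = 0 := by omega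
  rw [hdvd]
  interval_cases r <;> simp_all

theorem abelianReturnClasses_true_true_of_infConcat {w : ℕ → Bool}
    (hw : InfConcat
      {[true, true, false, false, true, false], [true, true, false, true, false, false]} w) :
    abelianReturnClasses w [true, true] =
      {(([true, true, false, false, true, false] : List Bool) : Multiset Bool)} := by
  have h := hw.exists_factorAt_eq_returnBlock
  have hocc := mem_abelianOccurrences_iff_six_dvd h
  have hclass : ∀ b, (returnBlock b : Multiset Bool) =
      (([true, true, false, false, true, false] : List Bool) : Multiset Bool) := by
    decide
  apply Set.eq_singleton_iff_unique_mem.2 ⟨?_, ?_⟩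
  · obtain ⟨b, hb⟩ := h 0
    refine ⟨factorAt w 0 6, ⟨0, 6, ?_, ?_, by norm_num, ?_, rfl⟩, ?_⟩
    · simp [hocc]
    · simp [hocc]
    · intro k _ _
      rw [hocc]
      omega
    · rw [← hclass b, ← hb]
  · rintro _ ⟨_, ⟨i, j, hi, hj, hij, hk, rfl⟩, rfl⟩
    rw [hocc] at hi hj
    obtain ⟨n, rfl⟩ := hi
    have hj6 : j = 6 * n + 6 := by
      by_contra hne
      exact hk (6 * n + 6) (by omega) (by omega) ((hocc _).2 (by omega))
    obtain ⟨b, hb⟩ := h n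
    subst hj6
    simp only [Nat.add_sub_cancel_left]
    rw [hb, hclass]

/-- The period-doubling word: the parity of the `2`-adic valuation of `n + 1`. -/
def periodDoubling (n : ℕ) : Bool :=
  decide (Even (padicValNat 2 (n + 1)))

theorem padicValNat_add_prime_pow {p x m : ℕ} [Fact p.Prime] (hx : 0 < x) (hxm : x < p ^ m) :
    padicValNat p (x + p ^ m) = padicValNat p x := by
  apply eq_of_forall_le_iff
  intro k
  rw [← padicValNat_dvd_iff_le hx.ne', ← padicValNat_dvd_iff_le (by omega)]
  rcases le_total k m with hkm | hmk
  · exact Nat.dvd_add_left (pow_dvd_pow p hkm)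
  · have hpow := pow_dvd_pow p hmk
    constructor <;> intro hk
    · exact absurd (Nat.le_of_dvd hx ((Nat.dvd_add_left dvd_rfl).1 (hpow.trans hk))) (by omega)
    · exact absurd (Nat.le_of_dvd hx (hpow.trans hk)) (by omega)

theorem periodDoubling_add_two_pow {n m : ℕ} (h : n + 1 < 2 ^ m) :
    periodDoubling (n + 2 ^ m) = periodDoubling n := by
  rw [periodDoubling, periodDoubling, add_right_comm, padicValNat_add_prime_pow n.succ_pos h]

theorem aperiodic_periodDoubling : Aperiodic periodDoubling := by
  rintro ⟨T, hT, hper⟩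
  have h := hper (T - 1)
  have h1 : T - 1 + 1 = T := by omega
  have h2 : T - 1 + T + 1 = 2 * T := by omega
  simp only [periodDoubling, h1, h2, padicValNat.mul two_ne_zero hT.ne', padicValNat_self,
    decide_eq_decide] at h
  rw [add_comm, Nat.even_add_one] at h
  tauto

/-- The image of `b` under the substitution `returnBlock`. -/
def blockWord (b : ℕ → Bool) (n : ℕ) : Bool :=
  (returnBlock (b (n / 6))).getD (n % 6) false

theorem factorAt_blockWord (b : ℕ → Bool) (n : ℕ) :
    factorAt (blockWord b) (6 * n) 6 = returnBlock (b n) := by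
  rw [factorAt_six_eq_returnBlock_iff]
  simp [blockWord, returnBlock, Nat.mul_add_div]

theorem blockWord_six_mul_add_three (b : ℕ → Bool) (n : ℕ) :
    blockWord b (6 * n + 3) = b n :=
  ((factorAt_six_eq_returnBlock_iff _ _ _).1 (factorAt_blockWord b n)).2.2.2.1

theorem Aperiodic.blockWord {b : ℕ → Bool} (hb : Aperiodic b) : Aperiodic (blockWord b) := by
  rintro ⟨T, hT, hper⟩
  refine hb ⟨T, hT, fun n => ?_⟩
  have h := (Function.Periodic.nat_mul (f := _root_.blockWord b) hper 6) (6 * n + 3)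
  rw [← blockWord_six_mul_add_three b n, ← h, ← blockWord_six_mul_add_three b (n + T)]
  congr 1
  push_cast
  ring

theorem recurrent_blockWord_periodDoubling : Recurrent (blockWord periodDoubling) := by
  rintro u ⟨i, hi⟩ N
  obtain ⟨m, hm⟩ : ∃ m, N + i + u.length + 1 < 2 ^ m := ⟨_, Nat.lt_two_pow_self⟩
  refine ⟨i + 6 * 2 ^ m, by omega, ?_⟩
  conv_rhs => rw [← hi]
  refine List.map_congr_left fun k hk => ?_
  rw [List.mem_range] at hk
  have hdiv : (i + 6 * 2 ^ m + k) / 6 = (i + k) / 6 + 2 ^ m := by omega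
  have hmod : (i + 6 * 2 ^ m + k) % 6 = (i + k) % 6 := by omega
  rw [blockWord, blockWord, hdiv, hmod, periodDoubling_add_two_pow (by omega)]

/-- In any infinite word which is an infinite concatenation of words from
`{110010, 110100}`, the factor `11` has exactly one abelian return, namely the abelian
class of `110010` (`≈ᵃᵇ 110100`).  In particular, there exist aperiodic recurrent infinite
words having a factor with exactly one abelian return. -/
theorem factor_11_has_one_abelian_return :
    (∀ w : ℕ → Bool,
      InfConcat
        {[true, true, false, false, true, false], [true, true, false, true, false, false]} w →
      abelianReturnClasses w [true, true] =
        {(([true, true, false, false, true, false] : List Bool) : Multiset Bool)}) ∧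
    ∃ w : ℕ → Bool, Aperiodic w ∧ Recurrent w ∧
      ∃ u : List Bool, IsFactor w u ∧ (abelianReturnClasses w u).encard = 1 := by
  refine ⟨fun w hw => abelianReturnClasses_true_true_of_infConcat hw,
    blockWord periodDoubling, aperiodic_periodDoubling.blockWord,
    recurrent_blockWord_periodDoubling, [true, true], ⟨0, by decide⟩, ?_⟩
  rw [abelianReturnClasses_true_true_of_infConcat
    (infConcat_of_forall_factorAt periodDoubling (factorAt_blockWord _)), Set.encard_singleton]
end

section
/- In the periodic infinite word w = (001101001011001100110011)^ω with period 24, every factor has at least two abelian returns. In particular, there exists a periodic infinite word each of whose factors has at least two abelian returns. -/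
variable {α : Type*}

/-- The word `001101001011001100110011`. -/
def periodBlock : List Bool :=
  [false, false, true, true, false, true, false, false, true, false, true, true,
   false, false, true, true, false, false, true, true, false, false, true, true]

/-- The periodic infinite word `(001101001011001100110011)^ω`. -/
def periodicExample : ℕ → Bool := fun n => periodBlock.getD (n % 24) false

@[simp]
theorem length_factorAt {α : Type*} (w : ℕ → α) (i n : ℕ) : (factorAt w i n).length = n := by
  simp [factorAt]

theorem factorAt_succ {α : Type*} (w : ℕ → α) (i n : ℕ) :
    factorAt w i (n + 1) = factorAt w i n ++ [w (i + n)] := by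
  simp [factorAt, List.range_succ]

/-- Binary words are abelian equivalent exactly when their lengths and their numbers of
occurrences of `true` agree. -/
theorem perm_iff_length_eq_and_count_true_eq (u v : List Bool) :
    u.Perm v ↔ u.length = v.length ∧ u.count true = v.count true := by
  refine ⟨fun h => ⟨h.length_eq, h.count_eq true⟩, fun ⟨hl, hc⟩ => ?_⟩
  have hu := List.count_true_add_count_false (l := u)
  have hv := List.count_true_add_count_false (l := v)
  rw [List.perm_iff_count]
  rintro (_ | _) <;> omega

/-- The number of occurrences of `true` among the first `n` letters of `periodicExample`. -/
def prefixCount (n : ℕ) : ℕ :=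
  12 * (n / 24) +
    [0, 0, 0, 1, 2, 2, 3, 3, 3, 4, 4, 5, 6, 6, 6, 7, 8, 8, 8, 9, 10, 10, 10, 11].getD (n % 24) 0

theorem prefixCount_add_mul (i q : ℕ) : prefixCount (i + 24 * q) = prefixCount i + 12 * q := by
  simp only [prefixCount, Nat.add_mul_mod_self_left,
    Nat.add_mul_div_left i q (by decide : 0 < 24)]
  ring

theorem prefixCount_succ (n : ℕ) :
    prefixCount (n + 1) = prefixCount n + (periodicExample n).toNat := by
  have hbase : ∀ m < 24,
      prefixCount (m + 1) = prefixCount m + (periodicExample m).toNat := by decide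
  have hm := hbase (n % 24) (Nat.mod_lt _ (by decide))
  have h₁ := prefixCount_add_mul (n % 24 + 1) (n / 24)
  have h₂ := prefixCount_add_mul (n % 24) (n / 24)
  have hw : periodicExample (n % 24) = periodicExample n := by
    simp [periodicExample]
  rw [show n % 24 + 1 + 24 * (n / 24) = n + 1 by omega] at h₁
  rw [Nat.mod_add_div] at h₂
  rw [hw] at hm
  omega

theorem count_true_factorAt_periodicExample (i n : ℕ) :
    (factorAt periodicExample i n).count true + prefixCount i = prefixCount (i + n) := by
  induction n with
  | zero => simp [factorAt]
  | succ n ih =>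
    rw [factorAt_succ, List.count_append, ← Nat.add_assoc i n 1, prefixCount_succ, ← ih]
    cases periodicExample (i + n) <;> simp [Nat.add_right_comm]

/-- The factor of length `n` of `periodicExample` at position `i` has exactly `c` letters `true`. -/
abbrev HasCount (n c i : ℕ) : Prop :=
  prefixCount (i + n) = prefixCount i + c

theorem hasCount_iff (n c i : ℕ) :
    HasCount n c i ↔ (factorAt periodicExample i n).count true = c := by
  have h := count_true_factorAt_periodicExample i n
  simp only [HasCount]
  omega

theorem hasCount_add_mul (n c i q : ℕ) :
    HasCount (n + 24 * q) (c + 12 * q) i ↔ HasCount n c i := by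
  simp only [HasCount, ← Nat.add_assoc, prefixCount_add_mul]
  omega

theorem hasCount_mod (n c i : ℕ) : HasCount n c (i % 24) ↔ HasCount n c i := by
  have h₁ := prefixCount_add_mul (i % 24) (i / 24)
  have h₂ := prefixCount_add_mul (i % 24 + n) (i / 24)
  rw [Nat.mod_add_div] at h₁
  rw [show i % 24 + n + 24 * (i / 24) = i + n by omega] at h₂
  simp only [HasCount]
  omega

/-- The factor of length `d` at position `j` is an abelian return word of the factors of length `n`
with exactly `c` letters `true`. -/
abbrev IsReturnAt (n c j d : ℕ) : Prop :=
  0 < d ∧ HasCount n c j ∧ HasCount n c (j + d) ∧ ∀ k < d, 0 < k → ¬ HasCount n c (j + k)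

set_option synthInstance.maxSize 1000 in
theorem exists_two_isReturnAt_of_lt : ∀ n < 24, ∀ c ≤ n, (∃ i < 24, HasCount n c i) →
    ∃ i < 24, HasCount n c i ∧ ∃ d < 25, IsReturnAt n c i d ∧
      ∃ j < 24, HasCount n c j ∧ ∃ e < 25, IsReturnAt n c j e ∧
        (d ≠ e ∨ prefixCount (i + d) + prefixCount j ≠ prefixCount (j + e) + prefixCount i) := by
  decide +kernel

theorem mem_abelianReturnClasses_of_isReturnAt {u : List Bool} {n c q j d : ℕ}
    (hlen : u.length = n + 24 * q) (hcount : u.count true = c + 12 * q) (h : IsReturnAt n c j d) :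
    (factorAt periodicExample j d : Multiset Bool) ∈ abelianReturnClasses periodicExample u := by
  have hocc (k : ℕ) : k ∈ AbelianOccurrences periodicExample u ↔ HasCount n c k := by
    rw [← hasCount_add_mul n c k q, hasCount_iff, ← hlen, ← hcount]
    simp [AbelianOccurrences, perm_iff_length_eq_and_count_true_eq]
  obtain ⟨hd, hj, hjd, hk⟩ := h
  refine ⟨_, ⟨j, j + d, (hocc _).2 hj, (hocc _).2 hjd, by omega, fun k hjk hkd => ?_,
    by rw [Nat.add_sub_cancel_left]⟩, rfl⟩
  have := hk (k - j) (by omega) (by omega)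
  rwa [Nat.add_sub_cancel' hjk.le, ← hocc] at this

theorem two_le_encard_abelianReturnClasses_periodicExample (u : List Bool)
    (hu : IsFactor periodicExample u) :
    2 ≤ (abelianReturnClasses periodicExample u).encard := by
  obtain ⟨i, hi⟩ := hu
  set n := u.length % 24
  set q := u.length / 24
  set c := (factorAt periodicExample i n).count true
  have hlen : u.length = n + 24 * q := (Nat.mod_add_div _ _).symm
  have hi_count : HasCount n c i := (hasCount_iff n c i).2 rfl
  have hcount : u.count true = c + 12 * q := by
    rwa [← hasCount_add_mul n c i q, ← hlen, hasCount_iff, hi] at hi_count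
  have hcn : c ≤ n := List.count_le_length.trans_eq (length_factorAt _ _ _)
  obtain ⟨k, -, -, d, -, hd, j, -, -, e, -, he, hne⟩ :=
    exists_two_isReturnAt_of_lt n (Nat.mod_lt _ (by decide)) c hcn
      ⟨i % 24, Nat.mod_lt _ (by decide), (hasCount_mod n c i).2 hi_count⟩
  have hd' := mem_abelianReturnClasses_of_isReturnAt hlen hcount hd
  have he' := mem_abelianReturnClasses_of_isReturnAt hlen hcount he
  refine le_trans (Set.encard_pair ?_).ge (Set.encard_le_encard (Set.pair_subset hd' he'))
  rw [Ne, Multiset.coe_eq_coe, perm_iff_length_eq_and_count_true_eq]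
  have h₁ := count_true_factorAt_periodicExample k d
  have h₂ := count_true_factorAt_periodicExample j e
  simp only [length_factorAt]
  omega

theorem periodic_periodicExample : Periodic periodicExample :=
  ⟨24, by decide, fun n => by simp [periodicExample]⟩

/-- In the periodic word `w = (001101001011001100110011)^ω` (of period
24), every factor has at least two abelian returns.  In particular, there exists a periodic
infinite word each of whose factors has at least two abelian returns. -/
theorem periodic_example_all_factors_at_least_two_abelian_returns :
    (∀ u : List Bool, IsFactor periodicExample u →
      2 ≤ (abelianReturnClasses periodicExample u).encard) ∧
    ∃ w : ℕ → Bool, Periodic w ∧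
      ∀ u : List Bool, IsFactor w u → 2 ≤ (abelianReturnClasses w u).encard :=
  ⟨two_le_encard_abelianReturnClasses_periodicExample, periodicExample, periodic_periodicExample,
    two_le_encard_abelianReturnClasses_periodicExample⟩
end
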